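/- Let p be a probability distribution on a finite set V and α > 0. Suppose each element v ∈ V independently samples X_v ~ Poisson(α·p_v), the set S = {v : X_v ≥ 1} is formed, and if S is nonempty exactly one element v is selected from S with probability X_v / Σ_{v'∈S} X_{v'}. Then the probability that nothing is selected equals e^{-α}, and each element v is selected with probability exactly (1 − e^{-α})·p_v. -/

import Mathlib

open Real

/-- The Poisson probability mass function with mean `μ` at `k`. -/
noncomputable def poissonPMF (μ : ℝ) (k : ℕ) : ℝ := Real.exp (-μ) * μ ^ k / (Nat.factorial k)

open Finset MeasureTheory in
theorem hasSum_prod_poissonPMF {V : Type*} [Fintype V] (m : V → ℝ) (hm : ∀ v, 0 ≤ m v) :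
    HasSum (fun x : V → ℕ => ∏ v, poissonPMF (m v) (x v)) 1 := by
  lift m to V → NNReal using hm
  let μ : Measure (V → ℕ) := Measure.pi fun v => ProbabilityTheory.poissonMeasure (m v)
  have h_val : ∀ x, (μ.toPMF x).toReal = ∏ v, poissonPMF (m v) (x v) := by
    intro x
    rw [Measure.toPMF_apply, Measure.pi_singleton, ENNReal.toReal_prod]
    exact prod_congr rfl fun v _ =>
      ProbabilityTheory.poissonMeasure_real_singleton (m v) (x v)
  have h_sum := (ENNReal.summable_toReal μ.toPMF.tsum_coe_ne_top).hasSum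
  rw [← ENNReal.tsum_toReal_eq μ.toPMF.apply_ne_top, μ.toPMF.tsum_coe] at h_sum
  simpa only [h_val, ENNReal.toReal_one] using h_sum

theorem poissonPMF_nonneg {m : ℝ} (hm : 0 ≤ m) (k : ℕ) : 0 ≤ poissonPMF m k := by
  unfold poissonPMF
  positivity

theorem poissonPMF_succ_mul (m : ℝ) (k : ℕ) :
    poissonPMF m (k + 1) * ((k + 1 : ℕ) : ℝ) = m * poissonPMF m k := by
  simp only [poissonPMF, Nat.factorial_succ, Nat.cast_mul]
  have h1 : ((k + 1 : ℕ) : ℝ) ≠ 0 := by positivity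
  have h2 : (k.factorial : ℝ) ≠ 0 := by positivity
  field_simp
  ring

theorem prod_poissonPMF_add_single_mul {V : Type*} [Fintype V] [DecidableEq V]
    (m : V → ℝ) (y : V → ℕ) (w : V) :
    (∏ v, poissonPMF (m v) ((y + Pi.single w 1 : V → ℕ) v)) * ((y w + 1 : ℕ) : ℝ) =
      m w * ∏ v, poissonPMF (m v) (y v) := by
  rw [← Finset.mul_prod_erase _ _ (Finset.mem_univ w),
    ← Finset.mul_prod_erase _ (fun v => poissonPMF (m v) (y v)) (Finset.mem_univ w)]
  have h : ∏ v ∈ Finset.univ.erase w, poissonPMF (m v) ((y + Pi.single w 1 : V → ℕ) v) =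
      ∏ v ∈ Finset.univ.erase w, poissonPMF (m v) (y v) := by
    refine Finset.prod_congr rfl fun v hv => ?_
    simp [Finset.ne_of_mem_erase hv]
  rw [h, Pi.add_apply, Pi.single_eq_same, mul_right_comm, poissonPMF_succ_mul, mul_assoc]

/-- The size-biasing identity: the probability that `w` is selected is its mean times a factor
which does not depend on `w`. -/
theorem tsum_prod_poissonPMF_mul_div {V : Type*} [Fintype V] [DecidableEq V]
    (m : V → ℝ) (w : V) :
    ∑' x : V → ℕ, (∏ v, poissonPMF (m v) (x v)) * ((x w : ℝ) / ∑ v, (x v : ℝ)) =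
      m w * ∑' y : V → ℕ, (∏ v, poissonPMF (m v) (y v)) / (∑ v, (y v : ℝ) + 1) := by
  have h_inj : Function.Injective fun y : V → ℕ => y + Pi.single w 1 :=
    add_left_injective _
  rw [← h_inj.tsum_eq, ← tsum_mul_left]
  · refine tsum_congr fun y => ?_
    have h_total : ∑ v, (((y + Pi.single w 1 : V → ℕ) v : ℕ) : ℝ) = ∑ v, (y v : ℝ) + 1 := by
      simp [Finset.sum_add_distrib, Pi.single_apply]
    rw [h_total, ← mul_div_assoc, ← mul_div_assoc, ← prod_poissonPMF_add_single_mul m y w]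
    simp
  · intro x hx
    have h_pos : x w ≠ 0 := by
      intro h
      simp [h] at hx
    refine ⟨x - Pi.single w 1, ?_⟩
    ext v
    by_cases hv : v = w
    · subst hv
      simp only [Pi.add_apply, Pi.sub_apply, Pi.single_eq_same]
      omega
    · simp [hv]

theorem prod_poissonPMF_zero {V : Type*} [Fintype V] (m : V → ℝ) :
    ∏ v, poissonPMF (m v) 0 = Real.exp (-∑ v, m v) := by
  simp [poissonPMF, ← Real.exp_sum, Finset.sum_neg_distrib]

theorem sum_tsum_prod_poissonPMF_mul_div {V : Type*} [Fintype V] [DecidableEq V]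
    (m : V → ℝ) (hm : ∀ v, 0 ≤ m v) :
    ∑ w, ∑' x : V → ℕ, (∏ v, poissonPMF (m v) (x v)) * ((x w : ℝ) / ∑ v, (x v : ℝ)) =
      1 - Real.exp (-∑ v, m v) := by
  have h_one := hasSum_prod_poissonPMF m hm
  have h_summable : ∀ w, Summable fun x : V → ℕ =>
      (∏ v, poissonPMF (m v) (x v)) * ((x w : ℝ) / ∑ v, (x v : ℝ)) := by
    intro w
    have h_nonneg : ∀ x : V → ℕ, 0 ≤ ∏ v, poissonPMF (m v) (x v) := fun x =>
      Finset.prod_nonneg fun v _ => poissonPMF_nonneg (hm v) _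
    refine h_one.summable.of_nonneg_of_le
      (fun x => mul_nonneg (h_nonneg x) (by positivity)) fun x => ?_
    refine mul_le_of_le_one_right (h_nonneg x) (div_le_one_of_le₀ ?_ (by positivity))
    exact Finset.single_le_sum (f := fun v => (x v : ℝ)) (fun v _ => by positivity)
      (Finset.mem_univ w)
  rw [← Summable.tsum_finsetSum fun w _ => h_summable w, ← prod_poissonPMF_zero]
  have h_sub := h_one.sub (hasSum_ite_eq (0 : V → ℕ) (∏ v, poissonPMF (m v) 0))
  rw [← h_sub.tsum_eq]
  refine tsum_congr fun x => ?_
  rw [← Finset.mul_sum, ← Finset.sum_div]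
  by_cases hx : x = 0
  · simp [hx]
  · have h_ne : ∑ v, (x v : ℝ) ≠ 0 := by
      intro h
      refine hx (funext fun v => ?_)
      exact_mod_cast (Finset.sum_eq_zero_iff_of_nonneg fun v _ => Nat.cast_nonneg (x v)).1 h v
        (Finset.mem_univ v)
    simp [hx, div_self h_ne]

/-- Poisson Multinomial Sampling protocol: with `X v ~ Poisson (α * p v)` independent,
`S = {v : X v ≥ 1}`, and one element of `S` selected with probability proportional to `X v`:
the probability nothing is selected is `e^{-α}`, and each `v₀` is selected with probability
exactly `(1 - e^{-α}) * p v₀`. -/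
theorem stmt0 {V : Type*} [Fintype V] [DecidableEq V] (p : V → ℝ) (α : ℝ)
    (hα : 0 < α) (hp : ∀ v, 0 ≤ p v) (hsum : ∑ v, p v = 1) :
    (∏ v, poissonPMF (α * p v) 0) = Real.exp (-α) ∧
    ∀ v0 : V,
      (∑' x : V → ℕ,
        (∏ v, poissonPMF (α * p v) (x v)) *
          (if 1 ≤ x v0 then (x v0 : ℝ) / (∑ v, (x v : ℝ)) else 0))
        = (1 - Real.exp (-α)) * p v0 := by
  have h_mean : ∑ v, α * p v = α := by rw [← Finset.mul_sum, hsum, mul_one]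
  refine ⟨by rw [prod_poissonPMF_zero, h_mean], fun v0 => ?_⟩
  have h_ite : ∀ x : V → ℕ,
      (if 1 ≤ x v0 then (x v0 : ℝ) / (∑ v, (x v : ℝ)) else 0) =
        (x v0 : ℝ) / ∑ v, (x v : ℝ) := by
    intro x
    split_ifs with h
    · rfl
    · simp [show x v0 = 0 by omega]
  have h_total := sum_tsum_prod_poissonPMF_mul_div (fun v => α * p v)
    fun v => mul_nonneg hα.le (hp v)
  simp only [tsum_prod_poissonPMF_mul_div (fun v => α * p v), ← Finset.sum_mul, h_mean]
    at h_total
  simp only [h_ite]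
  rw [tsum_prod_poissonPMF_mul_div (fun v => α * p v), ← h_total]
  ring
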